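/- Let J be a basic cylinder, K a subset of M_a, and f : J → K a surjective d_a-isometry. Let p ∈ J and q = f(p), and let F : GS(J,p) → M_a be the d_a-isometric extension of f defined by F(p + ∑ᵢ αᵢ(xᵢ − p)) = q + ∑ᵢ αᵢ(f(xᵢ) − q) for countable families (xᵢ) in J and reals (αᵢ) with p + ∑ᵢ αᵢ(xᵢ − p) ∈ M_a. Then for every u = (u₁,u₂,…) ∈ GS(J,p), F(u) − q = ∑_{i∈Λ(J)} (uᵢ − pᵢ)·(F(p + eᵢ) − q), where the series converges in M_a. -/

import Mathlib

open Filter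

noncomputable section

/-- Fix a sequence `a` of positive reals with `∑ aᵢ² < ∞`.  The space
`M_a` consists of the real sequences `x` with `∑ aᵢ² xᵢ² < ∞`. -/
def Ma (a : ℕ → ℝ) : Set (ℕ → ℝ) := {x | Summable fun i => (a i) ^ 2 * (x i) ^ 2}

/-- The inner product `⟨x,y⟩_a = ∑ aᵢ² xᵢ yᵢ` on `M_a`. -/
def innerA (a : ℕ → ℝ) (x y : ℕ → ℝ) : ℝ := ∑' i, (a i) ^ 2 * (x i * y i)

/-- The metric `d_a(x,y) = (∑ aᵢ² (xᵢ - yᵢ)²)^{1/2}`. -/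
def da (a : ℕ → ℝ) (x y : ℕ → ℝ) : ℝ := Real.sqrt (∑' i, (a i) ^ 2 * (x i - y i) ^ 2)

/-- `eᵢ`: the sequence with `1` in the `i`-th coordinate and `0` elsewhere. -/
def eSeq (i : ℕ) : ℕ → ℝ := Pi.single i 1

/-- `Λ(E) = {i | ∃ x ∈ E, ∃ α ≠ 0, x + α eᵢ ∈ E}`. -/
def Lam (E : Set (ℕ → ℝ)) : Set ℕ :=
  {i | ∃ x ∈ E, ∃ α : ℝ, α ≠ 0 ∧ x + α • eSeq i ∈ E}

/-- Convergence of the series `∑ᵢ f i` to `s` in `M_a`: the partial sums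
converge to `s` with respect to the metric `d_a`. -/
def ConvSeries (a : ℕ → ℝ) (f : ℕ → ℕ → ℝ) (s : ℕ → ℝ) : Prop :=
  Tendsto (fun n => da a (∑ i ∈ Finset.range n, f i) s) atTop (nhds 0)

/-- The generalized linear span `GS(E,p)`: all points `p + ∑ᵢ αᵢ (xᵢ - p) ∈ M_a`
with `xᵢ ∈ E`, `αᵢ ∈ ℝ`, the series converging in `M_a`. -/
def GS (a : ℕ → ℝ) (E : Set (ℕ → ℝ)) (p : ℕ → ℝ) : Set (ℕ → ℝ) :=
  {u | u ∈ Ma a ∧ ∃ x : ℕ → ℕ → ℝ, ∃ α : ℕ → ℝ,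
    (∀ i, x i ∈ E) ∧ ConvSeries a (fun i => α i • (x i - p)) (u - p)}

/-- `E` is a `d_a`-bounded set. -/
def BoundedA (a : ℕ → ℝ) (E : Set (ℕ → ℝ)) : Prop :=
  ∃ C : ℝ, ∀ x ∈ E, ∀ y ∈ E, da a x y ≤ C

/-- `f` is a `d_a`-isometry on `E`. -/
def IsIsomOn (a : ℕ → ℝ) (f : (ℕ → ℝ) → ℕ → ℝ) (E : Set (ℕ → ℝ)) : Prop :=
  ∀ x ∈ E, ∀ y ∈ E, da a (f x) (f y) = da a x y

/-- Data for a basic cylinder: each factor is a nonempty closed subinterval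
`[lo i, hi i] ⊆ [0,1]`, and all but finitely many factors equal `[0,1]`. -/
def IsBCData (lo hi : ℕ → ℝ) : Prop :=
  (∀ i, 0 ≤ lo i) ∧ (∀ i, lo i ≤ hi i) ∧ (∀ i, hi i ≤ 1) ∧
    {i | ¬(lo i = 0 ∧ hi i = 1)}.Finite

/-- The product set `∏ᵢ [lo i, hi i]`. -/
def cylSet (lo hi : ℕ → ℝ) : Set (ℕ → ℝ) := {x | ∀ i, x i ∈ Set.Icc (lo i) (hi i)}

/-- `J` is a basic cylinder. -/
def IsBasicCylinder (J : Set (ℕ → ℝ)) : Prop :=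
  ∃ lo hi : ℕ → ℝ, IsBCData lo hi ∧ J = cylSet lo hi

/-- The elementary volume of a basic cylinder: the product of the lengths of its
edges (a finite product; it is `0` exactly when some factor is a singleton). -/
def bcVol (lo hi : ℕ → ℝ) : ℝ := ∏ᶠ i, (hi i - lo i)

/-- `K` is a cylinder of volume `v`: there are a basic cylinder of elementary
volume `v` and a surjective `d_a`-isometry from it onto `K`. -/
def IsCylVol (a : ℕ → ℝ) (K : Set (ℕ → ℝ)) (v : ℝ) : Prop :=
  ∃ lo hi : ℕ → ℝ, IsBCData lo hi ∧ v = bcVol lo hi ∧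
    ∃ f : (ℕ → ℝ) → ℕ → ℝ, IsIsomOn a f (cylSet lo hi) ∧ f '' cylSet lo hi = K

/-- `K` is a cylinder. -/
def IsCylinder (a : ℕ → ℝ) (K : Set (ℕ → ℝ)) : Prop := ∃ v : ℝ, IsCylVol a K v

/-- The `d_a`-diameter of a set. -/
def daDiam (a : ℕ → ℝ) (K : Set (ℕ → ℝ)) : ℝ := sSup (Set.image2 (da a) K K)

/-- `μ_δ(E)`: the infimum of `∑ vol(Kᵢ)` over countable coverings of `E` by
cylinders of `d_a`-diameter `< δ` (`∞` if no such covering exists). -/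
def preMu (a : ℕ → ℝ) (δ : ℝ) (E : Set (ℕ → ℝ)) : ENNReal :=
  sInf {m : ENNReal | ∃ (K : ℕ → Set (ℕ → ℝ)) (v : ℕ → ℝ),
    (∀ n, IsCylVol a (K n) (v n)) ∧ (∀ n, daDiam a (K n) < δ) ∧
    (E ⊆ ⋃ n, K n) ∧ m = ∑' n, ENNReal.ofReal (v n)}

/-- The outer measure `μ(E) = lim_{δ→0⁺} μ_δ(E) = sup_{δ>0} μ_δ(E)`. -/
def muA (a : ℕ → ℝ) (E : Set (ℕ → ℝ)) : ENNReal :=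
  ⨆ (δ : ℝ) (_ : 0 < δ), preMu a δ E

/-- The Hilbert cube `I^ω = [0,1]^ℕ`, viewed as a subset of `M_a`. -/
def cube : Set (ℕ → ℝ) := {x | ∀ i, x i ∈ Set.Icc (0 : ℝ) 1}

section InnerProduct

variable {ι E E' : Type*} [NormedAddCommGroup E] [InnerProductSpace ℝ E]
  [NormedAddCommGroup E'] [InnerProductSpace ℝ E']

/-- Two families with the same norms and mutual distances have linear combinations of the
same norm. -/
theorem norm_sum_smul_eq_of_norm_sub_eq {x : ι → E} {y : ι → E'}
    (hn : ∀ i, ‖x i‖ = ‖y i‖) (hd : ∀ i j, ‖x i - x j‖ = ‖y i - y j‖)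
    (c : ι → ℝ) (s : Finset ι) : ‖∑ i ∈ s, c i • x i‖ = ‖∑ i ∈ s, c i • y i‖ := by
  have hinner : ∀ i j, inner ℝ (x i) (x j) = inner ℝ (y i) (y j) := fun i j => by
    have h1 := norm_sub_sq_real (x i) (x j)
    have h2 := norm_sub_sq_real (y i) (y j)
    rw [hd i j, hn i, hn j] at h1
    linarith
  rw [← sq_eq_sq₀ (norm_nonneg _) (norm_nonneg _), ← real_inner_self_eq_norm_sq,
    ← real_inner_self_eq_norm_sq]
  simp only [sum_inner, inner_sum, inner_smul_left, inner_smul_right, hinner]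

end InnerProduct

theorem memlp_two_mul_iff {a x : ℕ → ℝ} : Memℓp (fun i => a i * x i) 2 ↔ x ∈ Ma a := by
  rw [memℓp_gen_iff (by norm_num)]
  simp [Ma, mul_pow]

/-- `M_a` as a subspace of the space of all real sequences. -/
def maSubmodule (a : ℕ → ℝ) : Submodule ℝ (ℕ → ℝ) where
  carrier := Ma a
  zero_mem' := by simp [Ma, summable_zero]
  add_mem' {x y} hx hy := by
    rw [← memlp_two_mul_iff] at *
    convert hx.add hy using 1
    ext i
    simp [mul_add]
  smul_mem' c x hx := by
    rw [← memlp_two_mul_iff] at *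
    convert hx.const_smul c using 1
    ext i
    simp [mul_left_comm]

/-- The linear map `x ↦ (aᵢ xᵢ)` from `M_a` to `ℓ²`. -/
def toL2 (a : ℕ → ℝ) : maSubmodule a →ₗ[ℝ] lp (fun _ : ℕ => ℝ) 2 where
  toFun x := ⟨fun i => a i * x.1 i, memlp_two_mul_iff.2 x.2⟩
  map_add' x y := by
    ext i
    exact mul_add _ _ _
  map_smul' c x := by
    ext i
    simp [mul_left_comm]

theorem norm_toL2 {a : ℕ → ℝ} (x : maSubmodule a) :
    ‖toL2 a x‖ = √(∑' i, (a i) ^ 2 * (x.1 i) ^ 2) := by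
  rw [lp.norm_eq_tsum_rpow (by norm_num), Real.sqrt_eq_rpow]
  simp [toL2, mul_pow]

theorem da_eq_norm {a x y : ℕ → ℝ} (z : maSubmodule a) (h : x - y = z) :
    da a x y = ‖toL2 a z‖ := by
  rw [norm_toL2, ← h]
  rfl

theorem da_eq_zero_of_sub_notMem {a x y : ℕ → ℝ} (h : x - y ∉ maSubmodule a) :
    da a x y = 0 := by
  have h' : ¬ Summable fun i => (a i) ^ 2 * (x i - y i) ^ 2 := h
  rw [da, tsum_eq_zero_of_not_summable h', Real.sqrt_zero]

theorem mul_abs_sub_le_da {a x y : ℕ → ℝ} (h : x - y ∈ maSubmodule a)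
    (i : ℕ) : a i * |x i - y i| ≤ da a x y := by
  have h' : Summable fun i => (a i) ^ 2 * (x i - y i) ^ 2 := h
  refine Real.le_sqrt_of_sq_le ?_
  rw [mul_pow, sq_abs]
  exact h'.le_tsum i fun j _ => by positivity

theorem eq_of_da_eq_zero {a x y : ℕ → ℝ} (ha : ∀ i, 0 < a i) (h : x - y ∈ maSubmodule a)
    (h0 : da a x y = 0) : x = y := by
  ext i
  have h1 := mul_abs_sub_le_da h i
  rw [h0] at h1
  have h2 : |x i - y i| ≤ 0 := by
    by_contra! h3
    exact absurd (mul_pos (ha i) h3) (not_lt.2 h1)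
  exact sub_eq_zero.1 (abs_nonpos_iff.1 h2)

/-- Differences of values of an isometry lie in `M_a`, even if its values do not. -/
theorem IsIsomOn.sub_mem {a : ℕ → ℝ} (ha : ∀ i, 0 < a i) {F : (ℕ → ℝ) → ℕ → ℝ}
    {E : Set (ℕ → ℝ)} (hF : IsIsomOn a F E) (hE : E ⊆ Ma a) {x y : ℕ → ℝ} (hx : x ∈ E)
    (hy : y ∈ E) : F x - F y ∈ maSubmodule a := by
  by_contra h
  have h0 : da a x y = 0 := by rw [← hF x hx y hy, da_eq_zero_of_sub_notMem h]
  have hxy := eq_of_da_eq_zero ha ((maSubmodule a).sub_mem (hE hx) (hE hy)) h0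
  subst hxy
  simp at h

/-- A `d_a`-isometry preserves the norms of linear combinations of differences with a base
point. -/
theorem IsIsomOn.da_sum_smul_sub_eq {ι : Type*} {a : ℕ → ℝ} (ha : ∀ i, 0 < a i)
    {F : (ℕ → ℝ) → ℕ → ℝ} {E : Set (ℕ → ℝ)} (hF : IsIsomOn a F E) (hE : E ⊆ Ma a)
    {p : ℕ → ℝ} (hp : p ∈ E) {z : ι → ℕ → ℝ} (hz : ∀ i, z i ∈ E) (c : ι → ℝ)
    (s : Finset ι) :
    da a (∑ i ∈ s, c i • (F (z i) - F p)) 0 = da a (∑ i ∈ s, c i • (z i - p)) 0 := by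
  let x : ι → maSubmodule a := fun i => ⟨F (z i) - F p, hF.sub_mem ha hE (hz i) hp⟩
  let y : ι → maSubmodule a := fun i => ⟨z i - p, (maSubmodule a).sub_mem (hE (hz i)) (hE hp)⟩
  rw [da_eq_norm (∑ i ∈ s, c i • x i) (by simp [x]),
    da_eq_norm (∑ i ∈ s, c i • y i) (by simp [y])]
  simp only [map_sum, map_smul]
  refine norm_sum_smul_eq_of_norm_sub_eq (fun i => ?_) (fun i j => ?_) c s
  · rw [← da_eq_norm (x i) rfl, ← da_eq_norm (y i) rfl, hF _ (hz i) _ hp]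
  · rw [← map_sub, ← map_sub, ← da_eq_norm (x := F (z i)) (y := F (z j)) _ (by simp [x]),
      ← da_eq_norm (x := z i) (y := z j) _ (by simp [y]), hF _ (hz i) _ (hz j)]

theorem da_sub_zero {a x y : ℕ → ℝ} : da a (x - y) 0 = da a x y := by
  simp [da]

/-- The coordinate expansion of a point of `M_a` converges. -/
theorem convSeries_smul_eSeq {a c : ℕ → ℝ} (hc : c ∈ Ma a) :
    ConvSeries a (fun i => c i • eSeq i) c := by
  have hc' : Summable fun i => (a i) ^ 2 * (c i) ^ 2 := hc
  have hcoord : ∀ n j, (∑ i ∈ Finset.range n, c i • eSeq i) j = if j < n then c j else 0 := by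
    intro n j
    simp [eSeq, Finset.sum_apply, Pi.single_apply]
  have htail : ∀ n, da a (∑ i ∈ Finset.range n, c i • eSeq i) c =
      √(∑' k, (a (k + n)) ^ 2 * (c (k + n)) ^ 2) := by
    intro n
    have hzero : ∀ j ∈ Finset.range n,
        (a j) ^ 2 * ((∑ i ∈ Finset.range n, c i • eSeq i) j - c j) ^ 2 = 0 := by
      intro j hj
      rw [hcoord, if_pos (Finset.mem_range.1 hj)]
      simp
    have hshift : ∀ k, (a (k + n)) ^ 2 *
        ((∑ i ∈ Finset.range n, c i • eSeq i) (k + n) - c (k + n)) ^ 2 =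
        (a (k + n)) ^ 2 * (c (k + n)) ^ 2 := by
      intro k
      rw [hcoord, if_neg (by omega)]
      simp
    have hs : Summable fun j =>
        (a j) ^ 2 * ((∑ i ∈ Finset.range n, c i • eSeq i) j - c j) ^ 2 := by
      rw [← summable_nat_add_iff n]
      simp only [hshift]
      exact (summable_nat_add_iff n).2 hc'
    rw [da, ← hs.sum_add_tsum_nat_add n, Finset.sum_eq_zero hzero, zero_add]
    simp only [hshift]
  simp only [ConvSeries, htail]
  simpa using (tendsto_sum_nat_add fun i => (a i) ^ 2 * (c i) ^ 2).sqrt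

theorem mem_Lam_cylSet {lo hi p : ℕ → ℝ} (hp : p ∈ cylSet lo hi) {i : ℕ} :
    i ∈ Lam (cylSet lo hi) ↔ ∃ t : ℝ, t ≠ 0 ∧ p + t • eSeq i ∈ cylSet lo hi := by
  refine ⟨?_, fun ⟨t, ht, h⟩ => ⟨p, hp, t, ht, h⟩⟩
  rintro ⟨x, hx, t, ht, hxt⟩
  have hmem : ∀ b ∈ Set.Icc (lo i) (hi i), p + (b - p i) • eSeq i ∈ cylSet lo hi := by
    intro b hb j
    by_cases hji : j = i
    · subst hji
      simpa [eSeq] using hb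
    · simpa [eSeq, hji] using hp j
  by_cases hxp : x i = p i
  · refine ⟨_, ?_, hmem _ (hxt i)⟩
    simpa [eSeq, hxp] using ht
  · exact ⟨_, sub_ne_zero.2 hxp, hmem _ (hx i)⟩

theorem eq_of_notMem_Lam {lo hi p x : ℕ → ℝ} (hp : p ∈ cylSet lo hi)
    (hx : x ∈ cylSet lo hi) {i : ℕ} (hi' : i ∉ Lam (cylSet lo hi)) : x i = p i := by
  by_contra h
  refine hi' ((mem_Lam_cylSet hp).2 ⟨x i - p i, sub_ne_zero.2 h, fun j => ?_⟩)
  by_cases hji : j = i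
  · subst hji
    simpa [eSeq] using hx j
  · simpa [eSeq, hji] using hp j

theorem IsBCData.cylSet_subset_Ma {a lo hi : ℕ → ℝ} (hsum : Summable fun i => (a i) ^ 2)
    (hJ : IsBCData lo hi) : cylSet lo hi ⊆ Ma a := by
  intro x hx
  refine Summable.of_nonneg_of_le (fun i => by positivity) (fun i => ?_) hsum
  have h0 : 0 ≤ x i := (hJ.1 i).trans (hx i).1
  have h1 : x i ≤ 1 := (hx i).2.trans (hJ.2.2.1 i)
  exact mul_le_of_le_one_right (sq_nonneg _) (pow_le_one₀ h0 h1)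

theorem convSeries_single {a : ℕ → ℝ} (v : ℕ → ℝ) : ConvSeries a (Pi.single 0 v) v := by
  refine tendsto_const_nhds.congr' ?_
  filter_upwards [eventually_gt_atTop 0] with n hn
  rw [Finset.sum_pi_single', if_pos (Finset.mem_range.2 hn)]
  simp [da]

theorem add_smul_sub_mem_GS {a p x : ℕ → ℝ} {E : Set (ℕ → ℝ)} (hE : E ⊆ Ma a) (hp : p ∈ E)
    (hx : x ∈ E) (t : ℝ) : p + t • (x - p) ∈ GS a E p := by
  refine ⟨(maSubmodule a).add_mem (hE hp)
    ((maSubmodule a).smul_mem t ((maSubmodule a).sub_mem (hE hx) (hE hp))),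
    fun _ => x, Pi.single 0 t, fun _ => hx, ?_⟩
  convert convSeries_single (a := a) (t • (x - p)) using 1
  · ext i : 1
    by_cases hi : i = 0
    · subst hi
      simp
    · simp [hi]
  · simp

theorem add_eSeq_mem_GS {a lo hi p : ℕ → ℝ} (hE : cylSet lo hi ⊆ Ma a)
    (hp : p ∈ cylSet lo hi) {i : ℕ} (hi' : i ∈ Lam (cylSet lo hi)) :
    p + eSeq i ∈ GS a (cylSet lo hi) p := by
  obtain ⟨t, ht, hmem⟩ := (mem_Lam_cylSet hp).1 hi'
  simpa [smul_smul, ht] using add_smul_sub_mem_GS hE hp hmem t⁻¹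

theorem eq_of_mem_GS_of_notMem_Lam {a lo hi p u : ℕ → ℝ} (ha : ∀ i, 0 < a i)
    (hE : cylSet lo hi ⊆ Ma a) (hp : p ∈ cylSet lo hi) (hu : u ∈ GS a (cylSet lo hi) p)
    {i : ℕ} (hi' : i ∉ Lam (cylSet lo hi)) : u i = p i := by
  obtain ⟨huM, x, α, hx, hconv⟩ := hu
  have hle : ∀ n, a i * |u i - p i| ≤
      da a (∑ j ∈ Finset.range n, α j • (x j - p)) (u - p) := by
    intro n
    have hmem : (∑ j ∈ Finset.range n, α j • (x j - p)) - (u - p) ∈ maSubmodule a :=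
      (maSubmodule a).sub_mem
        ((maSubmodule a).sum_mem fun j _ => (maSubmodule a).smul_mem _
          ((maSubmodule a).sub_mem (hE (hx j)) (hE hp)))
        ((maSubmodule a).sub_mem huM (hE hp))
    have h := mul_abs_sub_le_da hmem i
    simpa [Finset.sum_apply, eq_of_notMem_Lam hp (hx _) hi', abs_sub_comm] using h
  have h0 := ge_of_tendsto' hconv hle
  have h1 : |u i - p i| ≤ 0 := by
    by_contra! h
    exact absurd (mul_pos (ha i) h) (not_lt.2 h0)
  exact sub_eq_zero.1 (abs_nonpos_iff.1 h1)

/-- For the extension `F` of a surjective `d_a`-isometry `f` on a basic cylinder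
`J`, one has `F(u) - q = ∑_{i ∈ Λ(J)} (uᵢ - pᵢ)(F(p + eᵢ) - q)` for every
`u ∈ GS(J,p)`, with convergence in `M_a`. -/
theorem ulam_stmt9 (a : ℕ → ℝ) (ha : ∀ i, 0 < a i)
    (hsum : Summable fun i => (a i) ^ 2)
    (lo hi : ℕ → ℝ) (hJ : IsBCData lo hi)
    (K : Set (ℕ → ℝ)) (f : (ℕ → ℝ) → ℕ → ℝ)
    (hf : IsIsomOn a f (cylSet lo hi)) (hfs : f '' cylSet lo hi = K)
    (p : ℕ → ℝ) (hp : p ∈ cylSet lo hi)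
    (F : (ℕ → ℝ) → ℕ → ℝ)
    (hFiso : IsIsomOn a F (GS a (cylSet lo hi) p))
    (hFext : ∀ (x : ℕ → ℕ → ℝ) (α : ℕ → ℝ) (v : ℕ → ℝ),
      (∀ i, x i ∈ cylSet lo hi) → v ∈ Ma a →
      ConvSeries a (fun i => α i • (x i - p)) (v - p) →
      ConvSeries a (fun i => α i • (f (x i) - f p)) (F v - f p))
    (u : ℕ → ℝ) (hu : u ∈ GS a (cylSet lo hi) p) :
    ConvSeries a
      ((Lam (cylSet lo hi)).indicator fun i => (u i - p i) • (F (p + eSeq i) - f p))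
      (F u - f p) := by
  classical
  have hE := hJ.cylSet_subset_Ma hsum
  have hGS : GS a (cylSet lo hi) p ⊆ Ma a := fun v hv => hv.1
  have hpGS : p ∈ GS a (cylSet lo hi) p := by
    simpa using add_smul_sub_mem_GS hE hp hp 0
  -- `F p = f p`, unless `F p - f p` lies outside `M_a`
  have hbase : F p - f p ∈ maSubmodule a → F p - f p = 0 := by
    intro hmem
    have h := hFext (fun _ => p) 0 p (fun _ => hp) hpGS.1 (by simp [ConvSeries, da])
    have h0 : da a 0 (F p - f p) = 0 := by
      simpa [ConvSeries] using h
    exact (eq_of_da_eq_zero ha (by simpa using (maSubmodule a).neg_mem hmem) h0).symm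
  have hcoeff : ∀ i ∉ Lam (cylSet lo hi), u i - p i = 0 := fun i hi' =>
    sub_eq_zero.2 (eq_of_mem_GS_of_notMem_Lam ha hE hp hu hi')
  let z : Option ℕ → ℕ → ℝ := fun o =>
    o.elim u fun i => if i ∈ Lam (cylSet lo hi) then p + eSeq i else p
  let c : Option ℕ → ℝ := fun o => o.elim (-1) fun i => u i - p i
  have hz : ∀ o, z o ∈ GS a (cylSet lo hi) p := by
    rintro (_ | i)
    · exact hu
    · by_cases hi' : i ∈ Lam (cylSet lo hi)
      · simpa [z, hi'] using add_eSeq_mem_GS hE hp hi'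
      · simpa [z, hi'] using hpGS
  have hsource : ∀ n, ∑ o ∈ (Finset.range n).insertNone, c o • (z o - p) =
      (∑ i ∈ Finset.range n, (u - p) i • eSeq i) - (u - p) := by
    intro n
    rw [Finset.sum_insertNone, sub_eq_add_neg _ (u - p), add_comm]
    congr 1
    · refine Finset.sum_congr rfl fun i _ => ?_
      by_cases hi' : i ∈ Lam (cylSet lo hi)
      · simp [c, z, hi']
      · simp [c, hcoeff i hi']
    · simp only [c, z, Option.elim]
      module
  have htarget : ∀ n, (∑ i ∈ Finset.range n, (Lam (cylSet lo hi)).indicator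
        (fun i => (u i - p i) • (F (p + eSeq i) - f p)) i) - (F u - f p) =
      ∑ o ∈ (Finset.range n).insertNone, c o • (F (z o) - F p) +
        ((∑ i ∈ Finset.range n, (u i - p i)) - 1) • (F p - f p) := by
    intro n
    have hterm : ∀ i, (Lam (cylSet lo hi)).indicator
        (fun i => (u i - p i) • (F (p + eSeq i) - f p)) i =
        c (some i) • (F (z (some i)) - F p) + (u i - p i) • (F p - f p) := by
      intro i
      by_cases hi' : i ∈ Lam (cylSet lo hi)
      · simp [c, z, hi', ← smul_add]
      · simp [c, hi', hcoeff i hi']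
    simp only [hterm, Finset.sum_add_distrib, Finset.sum_insertNone, ← Finset.sum_smul]
    simp only [c, z, Option.elim]
    module
  have hlim := convSeries_smul_eSeq (a := a) (c := u - p)
    ((maSubmodule a).sub_mem hu.1 hpGS.1)
  refine squeeze_zero (fun n => Real.sqrt_nonneg _) (fun n => ?_) hlim
  by_cases hmem : ((∑ i ∈ Finset.range n, (u i - p i)) - 1) • (F p - f p) ∈ maSubmodule a
  · have hzero : ((∑ i ∈ Finset.range n, (u i - p i)) - 1) • (F p - f p) = 0 := by
      by_cases hC : (∑ i ∈ Finset.range n, (u i - p i)) - 1 = 0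
      · rw [hC, zero_smul]
      · rw [hbase (((maSubmodule a).smul_mem_iff hC).1 hmem), smul_zero]
    rw [← da_sub_zero, htarget, hzero, add_zero,
      hFiso.da_sum_smul_sub_eq ha hGS hpGS hz c, hsource, da_sub_zero]
  · rw [da_eq_zero_of_sub_notMem]
    · exact Real.sqrt_nonneg _
    · rw [htarget, (maSubmodule a).add_mem_iff_right]
      · exact hmem
      · exact (maSubmodule a).sum_mem fun o _ => (maSubmodule a).smul_mem _
          (hFiso.sub_mem ha hGS (hz o) hpGS)
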